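/- Let c ∈ ℝ and suppose for every k ∈ ℂ, f(k,·) : [0,∞) → ℂ is a continuous solution of the Jost integral equation, with f'(k,0) := ik − ∫₀^b cos(ky) V(y) f(k,y) dy, and define the Jost function F(k) := −i·[ f'(k,0) + c·f(k,0) ]. Then F(k) − k − i(W/2 − c) → 0 as k → ∞ in the closed upper half plane {Im k ≥ 0}, and e^{−2ikb}·( F(k) − k − i(W/2 − c) ) → 0 as k → ∞ in the closed lower half plane {Im k ≤ 0}. -/

import Mathlib

open MeasureTheory Set Filter

/-- The kernel `s_k(t) = sin(kt)/k` for `k ≠ 0`, and `s_0(t) = t`. -/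
noncomputable def jostKernel (k : ℂ) (t : ℝ) : ℂ :=
  if k = 0 then (t : ℂ) else Complex.sin (k * t) / k

/-- A class-A potential: measurable, integrable on `(0,b)`, vanishing outside `(0,b)`. -/
def ClassA (b : ℝ) (V : ℝ → ℝ) : Prop :=
  Measurable V ∧ IntegrableOn V (Set.Ioo 0 b) ∧ ∀ x, x ∉ Set.Ioo 0 b → V x = 0

/-- `f` is a (continuous) solution of the Jost integral equation at parameter `k`. -/
def IsJostSolution (b : ℝ) (V : ℝ → ℝ) (k : ℂ) (f : ℝ → ℂ) : Prop :=
  ContinuousOn f (Set.Ici 0) ∧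
  (∀ x : ℝ, 0 ≤ x → x ≤ b →
      f x = Complex.exp (Complex.I * k * x)
        + ∫ y in x..b, jostKernel k (y - x) * (V y : ℂ) * f y) ∧
  ∀ x : ℝ, b ≤ x → f x = Complex.exp (Complex.I * k * x)

/-- Riemann–Lebesgue lemma for exponentials with frequency in the closed left half plane. -/
theorem exists_norm_integral_exp_mul_le {b : ℝ} (hb : 0 ≤ b) {U : ℝ → ℂ} (hU : Integrable U)
    {ε : ℝ} (hε : 0 < ε) :
    ∃ R : ℝ, 0 < R ∧ ∀ z : ℂ, z.re ≤ 0 → R ≤ ‖z‖ →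
      ‖∫ y in (0:ℝ)..b, Complex.exp (z * y) * U y‖ ≤ ε := by
  obtain ⟨g, hgc, hgs, hgU⟩ := (memLp_one_iff_integrable.2 hU).exist_eLpNorm_sub_le
    ENNReal.one_ne_top le_rfl (half_pos hε)
  have hgi : Integrable g := hgs.continuous.integrable_of_hasCompactSupport hgc
  have hg' : Continuous (deriv g) := hgs.continuous_deriv (by simp)
  have hdiff : ∫ y, ‖U y - g y‖ ≤ ε / 2 := by
    have h : Integrable fun y => U y - g y := hU.sub hgi
    rw [eLpNorm_one_eq_lintegral_enorm] at hgU
    rw [integral_norm_eq_lintegral_enorm h.aestronglyMeasurable]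
    exact ENNReal.toReal_le_of_le_ofReal (by positivity) (by simpa using hgU)
  have hexp : ∀ z : ℂ, z.re ≤ 0 → ∀ y : ℝ, 0 ≤ y → ‖Complex.exp (z * y)‖ ≤ 1 := by
    intro z hz y hy
    rw [Complex.norm_exp, Real.exp_le_one_iff]
    simpa using mul_nonpos_of_nonpos_of_nonneg hz hy
  set D : ℝ := ∫ y in (0:ℝ)..b, ‖deriv g y‖ with hD
  have hD0 : 0 ≤ D := intervalIntegral.integral_nonneg hb fun _ _ => norm_nonneg _
  set A : ℝ := ‖g b‖ + ‖g 0‖ + D with hA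
  have hA0 : 0 ≤ A := by positivity
  refine ⟨2 * A / ε + 1, by positivity, fun z hz hR => ?_⟩
  have hzpos : 0 < ‖z‖ := lt_of_lt_of_le (by positivity) hR
  have hec : Continuous fun y : ℝ => Complex.exp (z * y) := by fun_prop
  have hparts : z * ∫ y in (0:ℝ)..b, Complex.exp (z * y) * g y
      = Complex.exp (z * b) * g b - g 0 - ∫ y in (0:ℝ)..b, Complex.exp (z * y) * deriv g y := by
    have h := intervalIntegral.integral_deriv_mul_eq_sub (a := 0) (b := b)
      (u := fun y : ℝ => Complex.exp (z * y)) (u' := fun y : ℝ => z * Complex.exp (z * y))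
      (v := g) (v' := deriv g)
      (fun y _ => by
        have := ((hasDerivAt_id (y : ℂ)).const_mul z).cexp.comp_ofReal
        simpa [mul_comm] using this)
      (fun y _ => ((hgs.differentiable (by simp)) y).hasDerivAt)
      ((continuous_const.mul hec).intervalIntegrable _ _) (hg'.intervalIntegrable _ _)
    have hgcont := hgs.continuous
    have hi₁ : Continuous fun y : ℝ => z * Complex.exp (z * y) * g y := by fun_prop
    have hi₂ : Continuous fun y : ℝ => Complex.exp (z * y) * deriv g y := by fun_prop
    rw [intervalIntegral.integral_add (hi₁.intervalIntegrable _ _)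
      (hi₂.intervalIntegrable _ _)] at h
    simp only [mul_assoc, intervalIntegral.integral_const_mul] at h
    rw [eq_sub_iff_add_eq, h]
    simp
  have hsmooth : ‖∫ y in (0:ℝ)..b, Complex.exp (z * y) * g y‖ ≤ ε / 2 := by
    have h1 : ‖∫ y in (0:ℝ)..b, Complex.exp (z * y) * deriv g y‖ ≤ D := by
      refine intervalIntegral.norm_integral_le_of_norm_le hb
        (.of_forall fun y hy => ?_) (hg'.norm.intervalIntegrable _ _)
      rw [norm_mul]
      exact mul_le_of_le_one_left (norm_nonneg _) (hexp z hz y hy.1.le)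
    have h2 : ‖Complex.exp (z * b) * g b‖ ≤ ‖g b‖ := by
      rw [norm_mul]
      exact mul_le_of_le_one_left (norm_nonneg _) (hexp z hz b hb)
    have h3 : ‖z‖ * ‖∫ y in (0:ℝ)..b, Complex.exp (z * y) * g y‖ ≤ A := by
      rw [← norm_mul, hparts]
      refine (norm_sub_le _ _).trans ?_
      have := norm_sub_le (Complex.exp (z * b) * g b) (g 0)
      linarith
    have h4 : A ≤ ‖z‖ * (ε / 2) := by
      have : 2 * A / ε ≤ ‖z‖ := by linarith
      rw [div_le_iff₀ hε] at this
      linarith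
    exact le_of_mul_le_mul_left (h3.trans h4) hzpos
  have hrest : ‖∫ y in (0:ℝ)..b, Complex.exp (z * y) * (U y - g y)‖ ≤ ε / 2 := by
    have h1 : ‖∫ y in (0:ℝ)..b, Complex.exp (z * y) * (U y - g y)‖
        ≤ ∫ y in (0:ℝ)..b, ‖U y - g y‖ := by
      refine intervalIntegral.norm_integral_le_of_norm_le hb
        (.of_forall fun y hy => ?_) (hU.sub hgi).norm.intervalIntegrable
      rw [norm_mul]
      exact mul_le_of_le_one_left (norm_nonneg _) (hexp z hz y hy.1.le)
    refine h1.trans (le_trans ?_ hdiff)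
    rw [intervalIntegral.integral_of_le hb]
    exact setIntegral_le_integral (hU.sub hgi).norm (.of_forall fun _ => norm_nonneg _)
  have hsplit : ∫ y in (0:ℝ)..b, Complex.exp (z * y) * U y
      = (∫ y in (0:ℝ)..b, Complex.exp (z * y) * g y)
        + ∫ y in (0:ℝ)..b, Complex.exp (z * y) * (U y - g y) := by
    have hUg : Integrable fun y => U y - g y := hU.sub hgi
    rw [← intervalIntegral.integral_add (hgi.intervalIntegrable.continuousOn_mul hec.continuousOn)
      (hUg.intervalIntegrable.continuousOn_mul hec.continuousOn)]
    exact intervalIntegral.integral_congr fun y _ => by ring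
  rw [hsplit]
  refine (norm_add_le _ _).trans ?_
  linarith

theorem norm_exp_mul_cos_le_one {k q : ℂ} (hq : q = Complex.I * k ∨ q = -(Complex.I * k))
    (hre : q.re ≤ 0) {t : ℝ} (ht : 0 ≤ t) :
    ‖Complex.exp (q * t) * Complex.cos (k * t)‖ ≤ 1 := by
  have hinv : Complex.exp (q * t) * Complex.exp (-(q * t)) = 1 := by
    rw [← Complex.exp_add, add_neg_cancel, Complex.exp_zero]
  have hcos : Complex.cos (k * t) = (Complex.exp (q * t) + Complex.exp (-(q * t))) / 2 := by
    rw [Complex.cos]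
    rcases hq with rfl | rfl <;> ring_nf
  have h : Complex.exp (q * t) * Complex.cos (k * t) = (Complex.exp (q * t) ^ 2 + 1) / 2 := by
    rw [hcos]
    linear_combination (1 / 2) * hinv
  have he : ‖Complex.exp (q * t)‖ ≤ 1 := by
    rw [Complex.norm_exp, Real.exp_le_one_iff]
    simpa using mul_nonpos_of_nonpos_of_nonneg hre ht
  rw [h, norm_div, Complex.norm_ofNat, div_le_one two_pos]
  refine (norm_add_le _ _).trans ?_
  rw [norm_one, norm_pow]
  linarith [pow_le_one₀ (n := 2) (norm_nonneg _) he]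

theorem norm_exp_mul_sin_le_one {k q : ℂ} (hq : q = Complex.I * k ∨ q = -(Complex.I * k))
    (hre : q.re ≤ 0) {t : ℝ} (ht : 0 ≤ t) :
    ‖Complex.exp (q * t) * Complex.sin (k * t)‖ ≤ 1 := by
  have hinv : Complex.exp (q * t) * Complex.exp (-(q * t)) = 1 := by
    rw [← Complex.exp_add, add_neg_cancel, Complex.exp_zero]
  have hsin : ‖Complex.sin (k * t)‖ = ‖Complex.exp (q * t) - Complex.exp (-(q * t))‖ / 2 := by
    rw [Complex.sin, norm_div, norm_mul, Complex.norm_I, mul_one, Complex.norm_ofNat]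
    rcases hq with rfl | rfl
    · rw [norm_sub_rev]
      ring_nf
    · ring_nf
  have h : ‖Complex.exp (q * t) * Complex.sin (k * t)‖ = ‖Complex.exp (q * t) ^ 2 - 1‖ / 2 := by
    rw [norm_mul, hsin, mul_div_assoc', ← norm_mul, mul_sub, hinv, sq]
  have he : ‖Complex.exp (q * t)‖ ≤ 1 := by
    rw [Complex.norm_exp, Real.exp_le_one_iff]
    simpa using mul_nonpos_of_nonpos_of_nonneg hre ht
  rw [h, div_le_one two_pos]
  refine (norm_sub_le _ _).trans ?_
  rw [norm_one, norm_pow]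
  linarith [pow_le_one₀ (n := 2) (norm_nonneg _) he]

theorem norm_exp_mul_jostKernel_le {k q : ℂ} (hq : q = Complex.I * k ∨ q = -(Complex.I * k))
    (hre : q.re ≤ 0) (hk : k ≠ 0) {t : ℝ} (ht : 0 ≤ t) :
    ‖Complex.exp (q * t) * jostKernel k t‖ ≤ 1 / ‖k‖ := by
  rw [jostKernel, if_neg hk, mul_div_assoc', norm_div]
  gcongr
  exact norm_exp_mul_sin_le_one hq hre ht

/-- Weighted distance of a Jost solution from the free exponential, for large `k`. -/
theorem IsJostSolution.norm_weight_mul_sub_le {b : ℝ} (hb : 0 ≤ b) {V : ℝ → ℝ}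
    (hV : IntervalIntegrable V volume 0 b) {k q C : ℂ} {f : ℝ → ℂ} (hf : IsJostSolution b V k f)
    (hq : q = Complex.I * k ∨ q = -(Complex.I * k)) (hre : q.re ≤ 0) (hk : k ≠ 0)
    (hN : 2 * (∫ y in (0:ℝ)..b, |V y|) ≤ ‖k‖)
    (hC : ∀ y ∈ Icc 0 b, ‖C * Complex.exp (-(q * y)) * Complex.exp (Complex.I * k * y)‖ ≤ 1)
    {x : ℝ} (hx : x ∈ Icc 0 b) :
    ‖C * Complex.exp (-(q * x)) * (f x - Complex.exp (Complex.I * k * x))‖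
      ≤ 2 * (∫ y in (0:ℝ)..b, |V y|) / ‖k‖ := by
  obtain ⟨hcont, heq, -⟩ := hf
  have hkpos : 0 < ‖k‖ := norm_pos_iff.2 hk
  set N : ℝ := ∫ y in (0:ℝ)..b, |V y| with hNdef
  have hgc : ContinuousOn (fun y : ℝ => ‖C * Complex.exp (-(q * y)) * f y‖) (Icc 0 b) := by
    refine ContinuousOn.norm (ContinuousOn.mul ?_ (hcont.mono Icc_subset_Ici_self))
    fun_prop
  obtain ⟨x₀, hx₀, hmax⟩ := isCompact_Icc.exists_isMaxOn (nonempty_Icc.2 hb) hgc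
  set M : ℝ := ‖C * Complex.exp (-(q * x₀)) * f x₀‖ with hM
  have hM0 : 0 ≤ M := norm_nonneg _
  have key : ∀ x ∈ Icc 0 b,
      ‖C * Complex.exp (-(q * x)) * (f x - Complex.exp (Complex.I * k * x))‖
        ≤ M / ‖k‖ * N := by
    intro x hx
    have hsub : uIcc x b ⊆ uIcc 0 b := by
      rw [uIcc_of_le hx.2, uIcc_of_le hb]
      exact Icc_subset_Icc_left hx.1
    have hint : IntervalIntegrable (fun y => M / ‖k‖ * |V y|) volume 0 b := hV.abs.const_mul _
    rw [heq x hx.1 hx.2, add_sub_cancel_left, ← intervalIntegral.integral_const_mul,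
      hNdef, ← intervalIntegral.integral_const_mul]
    have h1 : ‖∫ y in x..b, C * Complex.exp (-(q * x))
          * (jostKernel k (y - x) * (V y : ℂ) * f y)‖ ≤ ∫ y in x..b, M / ‖k‖ * |V y| := by
      refine intervalIntegral.norm_integral_le_of_norm_le hx.2
        (.of_forall fun y hy => ?_) (hint.mono_set hsub)
      have hy' : y ∈ Icc 0 b := ⟨hx.1.trans hy.1.le, hy.2⟩
      have hexp : Complex.exp (-(q * x))
          = Complex.exp (q * ((y - x : ℝ) : ℂ)) * Complex.exp (-(q * y)) := by
        rw [← Complex.exp_add]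
        congr 1
        push_cast
        ring
      have : C * Complex.exp (-(q * x)) * (jostKernel k (y - x) * (V y : ℂ) * f y)
          = (Complex.exp (q * ((y - x : ℝ) : ℂ)) * jostKernel k (y - x))
            * (C * Complex.exp (-(q * y)) * f y) * (V y : ℂ) := by
        rw [hexp]
        ring
      rw [this, norm_mul, norm_mul, Complex.norm_real, Real.norm_eq_abs]
      gcongr
      calc _ ≤ 1 / ‖k‖ * M := by
            gcongr
            · exact norm_exp_mul_jostKernel_le hq hre hk (by linarith [hy.1])
            · exact hmax hy'
        _ = M / ‖k‖ := by ring
    refine h1.trans ?_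
    exact intervalIntegral.integral_mono_interval hx.1 hx.2 le_rfl
      (.of_forall fun y => by positivity) hint
  have hM2 : M ≤ 2 := by
    have h1 := key x₀ hx₀
    have h2 := hC x₀ hx₀
    have h3 : M ≤ 1 + M / ‖k‖ * N := by
      have : C * Complex.exp (-(q * x₀)) * f x₀
          = C * Complex.exp (-(q * x₀)) * Complex.exp (Complex.I * k * x₀)
            + C * Complex.exp (-(q * x₀)) * (f x₀ - Complex.exp (Complex.I * k * x₀)) := by ring
      rw [hM, this]
      refine (norm_add_le _ _).trans ?_
      rw [← this]
      exact add_le_add h2 h1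
    have h4 : M / ‖k‖ * N ≤ M / 2 := by
      rw [div_mul_eq_mul_div, div_le_iff₀ hkpos]
      nlinarith
    linarith
  refine (key x hx).trans ?_
  have hN0 : 0 ≤ N := intervalIntegral.integral_nonneg hb fun _ _ => abs_nonneg _
  rw [div_mul_eq_mul_div]
  gcongr

/-- Weighted bound for the remainder `F(k) - k - i(W/2 - c)` of the Jost function. -/
theorem IsJostSolution.norm_weight_mul_remainder_le {b : ℝ} (hb : 0 ≤ b) {V : ℝ → ℝ}
    (hV : IntervalIntegrable V volume 0 b) {k q C : ℂ} {f : ℝ → ℂ} (hf : IsJostSolution b V k f)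
    (hq : q = Complex.I * k ∨ q = -(Complex.I * k)) (hre : q.re ≤ 0) (hk : k ≠ 0)
    (hN : 2 * (∫ y in (0:ℝ)..b, |V y|) ≤ ‖k‖)
    (hC : ∀ y ∈ Icc 0 b, ‖C * Complex.exp (-(q * y)) * Complex.exp (Complex.I * k * y)‖ ≤ 1)
    (c : ℝ) :
    ‖C * (-Complex.I * (Complex.I * k
        - (∫ y in (0:ℝ)..b, Complex.cos (k * y) * (V y : ℂ) * f y) + (c : ℂ) * f 0)
        - k - Complex.I * (((∫ y in (0:ℝ)..b, V y : ℝ) : ℂ) / 2 - (c : ℂ)))‖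
      ≤ ‖∫ y in (0:ℝ)..b, C * Complex.exp (2 * Complex.I * k * y) * (V y : ℂ)‖
        + 2 * (∫ y in (0:ℝ)..b, |V y|) * ((∫ y in (0:ℝ)..b, |V y|) + |c|) / ‖k‖ := by
  have key := fun x (hx : x ∈ Icc 0 b) => hf.norm_weight_mul_sub_le hb hV hq hre hk hN hC hx
  set N : ℝ := ∫ y in (0:ℝ)..b, |V y| with hNdef
  set δ : ℝ := 2 * N / ‖k‖ with hδ
  have hVc : IntervalIntegrable (fun y => (V y : ℂ)) volume 0 b :=
    ⟨hV.1.ofReal, hV.2.ofReal⟩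
  have hfc : ContinuousOn f (uIcc 0 b) := by
    rw [uIcc_of_le hb]
    exact hf.1.mono Icc_subset_Ici_self
  set J : ℂ := ∫ y in (0:ℝ)..b, C * Complex.cos (k * y)
    * (f y - Complex.exp (Complex.I * k * y)) * (V y : ℂ) with hJ
  set P : ℂ := ∫ y in (0:ℝ)..b, C * Complex.exp (2 * Complex.I * k * y) * (V y : ℂ) with hP
  have hPi : IntervalIntegrable
      (fun y : ℝ => C * Complex.exp (2 * Complex.I * k * y) * (V y : ℂ)) volume 0 b :=
    hVc.continuousOn_mul (by fun_prop)
  have hJi : IntervalIntegrable (fun y : ℝ => C * Complex.cos (k * y)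
      * (f y - Complex.exp (Complex.I * k * y)) * (V y : ℂ)) volume 0 b := by
    refine hVc.continuousOn_mul (ContinuousOn.mul (by fun_prop) (hfc.sub (by fun_prop)))
  have hdecomp : C * (∫ y in (0:ℝ)..b, Complex.cos (k * y) * (V y : ℂ) * f y)
      = P / 2 + C * (((∫ y in (0:ℝ)..b, V y : ℝ) : ℂ) / 2) + J := by
    rw [← intervalIntegral.integral_ofReal]
    have h : P / 2 + C * ((∫ y in (0:ℝ)..b, (V y : ℂ)) / 2) + J
        = ∫ y in (0:ℝ)..b, ((1 / 2) * (C * Complex.exp (2 * Complex.I * k * y) * (V y : ℂ))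
          + (C / 2) * (V y : ℂ) + C * Complex.cos (k * y)
            * (f y - Complex.exp (Complex.I * k * y)) * (V y : ℂ)) := by
      rw [intervalIntegral.integral_add ((hPi.const_mul _).add (hVc.const_mul _)) hJi,
        intervalIntegral.integral_add (hPi.const_mul _) (hVc.const_mul _),
        intervalIntegral.integral_const_mul, intervalIntegral.integral_const_mul]
      ring
    rw [h, ← intervalIntegral.integral_const_mul]
    refine intervalIntegral.integral_congr fun y _ => ?_
    have hce : Complex.cos (k * y) * Complex.exp (Complex.I * k * y)
        = (Complex.exp (2 * Complex.I * k * y) + 1) / 2 := by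
      rw [Complex.cos, div_mul_eq_mul_div, add_mul, ← Complex.exp_add, ← Complex.exp_add]
      congr 2
      · congr 1
        ring
      · rw [Complex.exp_eq_one_iff]
        exact ⟨0, by push_cast; ring⟩
    linear_combination (C * (V y : ℂ)) * hce
  have hJle : ‖J‖ ≤ δ * N := by
    rw [hNdef, ← intervalIntegral.integral_const_mul]
    refine intervalIntegral.norm_integral_le_of_norm_le hb
      (.of_forall fun y hy => ?_) (hV.abs.const_mul _)
    have hexp : Complex.exp (q * y) * Complex.exp (-(q * y)) = 1 := by
      rw [← Complex.exp_add, add_neg_cancel, Complex.exp_zero]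
    have : C * Complex.cos (k * y) * (f y - Complex.exp (Complex.I * k * y)) * (V y : ℂ)
        = (Complex.exp (q * y) * Complex.cos (k * y)) * (C * Complex.exp (-(q * y))
          * (f y - Complex.exp (Complex.I * k * y))) * (V y : ℂ) := by
      linear_combination (-(C * Complex.cos (k * y)
        * (f y - Complex.exp (Complex.I * k * y)) * (V y : ℂ))) * hexp
    rw [this, norm_mul, norm_mul, Complex.norm_real, Real.norm_eq_abs]
    gcongr
    calc _ ≤ 1 * δ := by
          gcongr
          · exact norm_exp_mul_cos_le_one hq hre hy.1.le
          · exact key y ⟨hy.1.le, hy.2⟩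
      _ = δ := one_mul _
  have h0 : ‖C * (f 0 - 1)‖ ≤ δ := by simpa using key 0 ⟨le_rfl, hb⟩
  have hmain : C * (-Complex.I * (Complex.I * k
        - (∫ y in (0:ℝ)..b, Complex.cos (k * y) * (V y : ℂ) * f y) + (c : ℂ) * f 0)
        - k - Complex.I * (((∫ y in (0:ℝ)..b, V y : ℝ) : ℂ) / 2 - (c : ℂ)))
      = Complex.I * (P / 2 + J - (c : ℂ) * (C * (f 0 - 1))) := by
    linear_combination Complex.I * hdecomp - C * k * Complex.I_mul_I
  rw [hmain, norm_mul, Complex.norm_I, one_mul]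
  have hP2 : ‖P / 2‖ ≤ ‖P‖ := by
    rw [norm_div, Complex.norm_ofNat]
    linarith [norm_nonneg P]
  have hc0 : ‖(c : ℂ) * (C * (f 0 - 1))‖ ≤ |c| * δ := by
    rw [norm_mul, Complex.norm_real, Real.norm_eq_abs]
    gcongr
  have hsum : 2 * N * (N + |c|) / ‖k‖ = δ * N + |c| * δ := by
    rw [hδ]
    ring
  rw [hsum]
  have h1 := norm_sub_le (P / 2 + J) ((c : ℂ) * (C * (f 0 - 1)))
  have h2 := norm_add_le (P / 2) J
  linarith

/-- large-`k` asymptotics of the Jost function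
`F(k) = -i[f'(k,0) + c·f(k,0)]` in the closed upper and lower half planes. -/
theorem jost_function_asymptotics (b : ℝ) (hb : 0 < b) (V : ℝ → ℝ) (hV : ClassA b V)
    (c : ℝ)
    (f : ℂ → ℝ → ℂ) (hf : ∀ k : ℂ, IsJostSolution b V k (f k))
    (W : ℝ) (hW : W = ∫ y in (0:ℝ)..b, V y)
    (f' : ℂ → ℂ)
    (hf' : ∀ k : ℂ, f' k
      = Complex.I * k - ∫ y in (0:ℝ)..b, Complex.cos (k * y) * (V y : ℂ) * f k y)
    (F : ℂ → ℂ) (hF : ∀ k : ℂ, F k = -Complex.I * (f' k + (c : ℂ) * f k 0)) :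
    (∀ ε : ℝ, 0 < ε → ∃ R : ℝ, 0 < R ∧ ∀ k : ℂ, 0 ≤ k.im → R ≤ ‖k‖ →
      ‖F k - k - Complex.I * ((W : ℂ) / 2 - (c : ℂ))‖ ≤ ε) ∧
    (∀ ε : ℝ, 0 < ε → ∃ R : ℝ, 0 < R ∧ ∀ k : ℂ, k.im ≤ 0 → R ≤ ‖k‖ →
      ‖Complex.exp (-2 * Complex.I * k * b)
        * (F k - k - Complex.I * ((W : ℂ) / 2 - (c : ℂ)))‖ ≤ ε) := by
  subst hW
  obtain ⟨-, hVi, hV0⟩ := hV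
  have hVint : Integrable V := by
    rw [← integrableOn_univ]
    exact hVi.of_forall_sdiff_eq_zero MeasurableSet.univ fun x hx => hV0 x hx.2
  have hVc : Integrable fun y => (V y : ℂ) := hVint.ofReal
  have hVI : IntervalIntegrable V volume 0 b := hVint.intervalIntegrable
  set N : ℝ := ∫ y in (0:ℝ)..b, |V y| with hN
  have hN0 : 0 ≤ N := intervalIntegral.integral_nonneg hb.le fun _ _ => abs_nonneg _
  set A : ℝ := 2 * N * (N + |c|) with hA
  have hA0 : 0 ≤ A := by positivity
  have small : ∀ ε : ℝ, 0 < ε → ∀ k : ℂ, 0 < ‖k‖ → 2 * A / ε ≤ ‖k‖ → A / ‖k‖ ≤ ε / 2 := by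
    intro ε hε k hk h
    rw [div_le_iff₀ hε] at h
    rw [div_le_iff₀ hk]
    linarith
  constructor
  · intro ε hε
    obtain ⟨R, hR, hRL⟩ := exists_norm_integral_exp_mul_le hb.le hVc (half_pos hε)
    refine ⟨R + 2 * N + 2 * A / ε, by positivity, fun k hk hkR => ?_⟩
    have hA' : 0 ≤ 2 * A / ε := by positivity
    have hkpos : 0 < ‖k‖ := by linarith
    have h := (hf k).norm_weight_mul_remainder_le (C := 1) hb.le hVI (Or.inl rfl) (by simpa using hk)
      (norm_pos_iff.1 hkpos) (by linarith)
      (fun y _ => by rw [one_mul, ← Complex.exp_add, neg_add_cancel, Complex.exp_zero, norm_one]) c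
    rw [hF, hf']
    rw [one_mul] at h
    have hP := hRL (2 * Complex.I * k) (by simpa using hk) (by
      rw [norm_mul, norm_mul, Complex.norm_I, Complex.norm_ofNat]
      linarith)
    simp only [one_mul] at h
    linarith [small ε hε k hkpos (by linarith)]
  · intro ε hε
    obtain ⟨R, hR, hRL⟩ := exists_norm_integral_exp_mul_le hb.le (hVc.comp_sub_left b) (half_pos hε)
    refine ⟨R + 2 * N + 2 * A / ε, by positivity, fun k hk hkR => ?_⟩
    have hA' : 0 ≤ 2 * A / ε := by positivity
    have hkpos : 0 < ‖k‖ := by linarith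
    have h := (hf k).norm_weight_mul_remainder_le (C := Complex.exp (-2 * Complex.I * k * b))
      hb.le hVI (Or.inr rfl) (by simpa using hk) (norm_pos_iff.1 hkpos) (by linarith)
      (fun y hy => by
        rw [← Complex.exp_add, ← Complex.exp_add, Complex.norm_exp, Real.exp_le_one_iff]
        simp
        nlinarith [hy.2]) c
    rw [hF, hf']
    have hP := hRL (-2 * Complex.I * k) (by simp; linarith) (by
      rw [norm_mul, norm_mul, Complex.norm_I, norm_neg, Complex.norm_ofNat]
      linarith)
    have hrefl : ∫ y in (0:ℝ)..b, Complex.exp (-2 * Complex.I * k * b)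
          * Complex.exp (2 * Complex.I * k * y) * (V y : ℂ)
        = ∫ y in (0:ℝ)..b, Complex.exp (-2 * Complex.I * k * y) * (V (b - y) : ℂ) := by
      have := intervalIntegral.integral_comp_sub_left (a := 0) (b := b)
        (fun y : ℝ => Complex.exp (-2 * Complex.I * k * b)
          * Complex.exp (2 * Complex.I * k * y) * (V y : ℂ)) b
      rw [sub_self, sub_zero] at this
      rw [← this]
      refine intervalIntegral.integral_congr fun y _ => ?_
      rw [← Complex.exp_add]
      congr 2
      push_cast
      ring
    rw [hrefl] at h
    linarith [small ε hε k hkpos (by linarith)]
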